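/- arXiv:1701.03718 — 2 statements merged into one kernel-verified Lean document; each statement's English description precedes it below -/
import Mathlib

section
/- Let n ≥ 1 be an integer, V ≠ 0 a real number, θ, u ∈ ℝⁿ, g an invertible symmetric n×n real matrix, and C an arbitrary n×n real matrix; set B = C − Cᵀ. Let G be the stationary metric matrix built from V, θ, g, with inverse H, and let F be the antisymmetric (n+1)×(n+1) matrix with F₀ⱼ = −uⱼ = −Fⱼ₀ (1 ≤ j ≤ n) and Fᵢⱼ = Bᵢⱼ (1 ≤ i,j ≤ n). Then |F|² := Σ_{μ,ν,α,β} H^{μα}H^{νβ}F_{μν}F_{αβ} = 2[ Σ_{i,j,k,l} B_{ij} g^{ik} g^{jl} (C_{kl} − 2 u_k θ_l) + (uᵀg⁻¹u)(θᵀg⁻¹θ − V⁻²) − (uᵀg⁻¹θ)² ], where g^{ik} denotes the entries of g⁻¹. -/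
open Matrix

/-- The stationary metric matrix `G` of the spacetime metric
`𝐠 = −V²(dt + θᵢdxⁱ)² + gᵢⱼdxⁱdxʲ`. -/
def statMetric (n : ℕ) (V : ℝ) (θ : Fin n → ℝ) (g : Matrix (Fin n) (Fin n) ℝ) :
    Matrix (Unit ⊕ Fin n) (Unit ⊕ Fin n) ℝ :=
  Matrix.fromBlocks
    (Matrix.of fun _ _ => -V ^ 2)
    (Matrix.of fun _ j => -V ^ 2 * θ j)
    (Matrix.of fun i _ => -V ^ 2 * θ i)
    (Matrix.of fun i j => g i j - V ^ 2 * θ i * θ j)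

/-- The inverse of the stationary metric matrix, in block form. -/
theorem statMetric_inv (n : ℕ) (V : ℝ) (hV : V ≠ 0) (θ : Fin n → ℝ)
    (g : Matrix (Fin n) (Fin n) ℝ) (hgs : g.IsSymm) (hg : IsUnit g) :
    (statMetric n V θ g)⁻¹ = Matrix.fromBlocks
      (Matrix.of fun _ _ => θ ⬝ᵥ (g⁻¹ *ᵥ θ) - (V ^ 2)⁻¹)
      (Matrix.of fun _ j => -(g⁻¹ *ᵥ θ) j)
      (Matrix.of fun i _ => -(g⁻¹ *ᵥ θ) i)
      g⁻¹ := by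
  have hdet : IsUnit g.det := (Matrix.isUnit_iff_isUnit_det g).mp hg
  have hgp : g *ᵥ (g⁻¹ *ᵥ θ) = θ := by
    rw [Matrix.mulVec_mulVec, Matrix.mul_nonsing_inv g hdet, Matrix.one_mulVec]
  have hPs : (g⁻¹)ᵀ = g⁻¹ := by rw [Matrix.transpose_nonsing_inv, hgs.eq]
  have hθP : ∀ j, ∑ k, θ k * g⁻¹ k j = (g⁻¹ *ᵥ θ) j := fun j => by
    rw [← Matrix.vecMul_transpose, hPs]
    rfl
  have hgpi : ∀ i, ∑ k, g i k * (g⁻¹ *ᵥ θ) k = θ i := fun i => congrFun hgp i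
  have hgP : ∀ i j, ∑ k, g i k * g⁻¹ k j = (1 : Matrix (Fin n) (Fin n) ℝ) i j := fun i j => by
    rw [← Matrix.mul_nonsing_inv g hdet, Matrix.mul_apply]
  apply Matrix.inv_eq_right_inv
  rw [statMetric, Matrix.fromBlocks_multiply, ← Matrix.fromBlocks_one]
  generalize g⁻¹ *ᵥ θ = p at *
  congr 1 <;> ext i j <;>
    simp only [Matrix.add_apply, Matrix.mul_apply, Matrix.of_apply, Finset.univ_unique,
      Finset.sum_singleton, Matrix.zero_apply, sub_mul, mul_neg, mul_assoc, neg_mul,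
      Finset.sum_sub_distrib, Finset.sum_neg_distrib, ← Finset.mul_sum, hθP, hgpi, hgP,
      dotProduct]
  · rw [Subsingleton.elim i j, Matrix.one_apply_eq]
    field_simp
    ring
  · ring
  · field_simp
    ring
  · ring

/-- Let n ≥ 1 be an integer, V ≠ 0 a real number, θ, u ∈ ℝⁿ, g an
invertible symmetric n×n real matrix, and C an arbitrary n×n real matrix; set
B = C − Cᵀ.  Let G be the stationary metric matrix built from V, θ, g, with inverse H,
and let F be the antisymmetric (n+1)×(n+1) matrix with F₀ⱼ = −uⱼ = −Fⱼ₀ and Fᵢⱼ = Bᵢⱼ.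
Then |F|² = Σ H^{μα}H^{νβ}F_{μν}F_{αβ}
  = 2[ Σ B_{ij} g^{ik} g^{jl} (C_{kl} − 2 u_k θ_l) + (uᵀg⁻¹u)(θᵀg⁻¹θ − V⁻²) − (uᵀg⁻¹θ)² ]. -/
theorem maxwell_F_squared (n : ℕ) (hn : 1 ≤ n) (V : ℝ) (hV : V ≠ 0)
    (θ u : Fin n → ℝ) (g : Matrix (Fin n) (Fin n) ℝ)
    (hgs : g.IsSymm) (hg : IsUnit g) (C : Matrix (Fin n) (Fin n) ℝ) :
    let B := C - Cᵀ
    let H := (statMetric n V θ g)⁻¹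
    let F : Matrix (Unit ⊕ Fin n) (Unit ⊕ Fin n) ℝ :=
      Matrix.fromBlocks 0 (Matrix.of fun _ j => -u j) (Matrix.of fun i _ => u i) B
    ∑ μ, ∑ ν, ∑ α, ∑ β, H μ α * H ν β * F μ ν * F α β =
      2 * ((∑ i, ∑ j, ∑ k, ∑ l, B i j * g⁻¹ i k * g⁻¹ j l * (C k l - 2 * u k * θ l))
        + (u ⬝ᵥ (g⁻¹ *ᵥ u)) * (θ ⬝ᵥ (g⁻¹ *ᵥ θ) - (V ^ 2)⁻¹)
        - (u ⬝ᵥ (g⁻¹ *ᵥ θ)) ^ 2) := by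
  intro B H F
  have hPs : ∀ i j, g⁻¹ i j = g⁻¹ j i := fun i j => by
    conv_lhs => rw [← hgs.eq, ← Matrix.transpose_nonsing_inv, Matrix.transpose_apply]
  have hB : ∀ i j, B i j = C i j - C j i := fun i j => rfl
  have hBa : ∀ i j, B i j = -B j i := fun i j => by rw [hB, hB, neg_sub]
  simp only [H, F, statMetric_inv n V hV θ g hgs hg]
  generalize B = B at *
  generalize θ ⬝ᵥ (g⁻¹ *ᵥ θ) - (V ^ 2)⁻¹ = s
  have hp : ∀ i, ∑ l, g⁻¹ i l * θ l = (g⁻¹ *ᵥ θ) i := fun i => rfl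
  have hq : ∀ i, ∑ l, g⁻¹ i l * u l = (g⁻¹ *ᵥ u) i := fun i => rfl
  generalize g⁻¹ *ᵥ θ = p at *
  generalize g⁻¹ *ᵥ u = q at *
  generalize g⁻¹ = P at *
  have hBB : ∑ i, ∑ j, ∑ k, ∑ l, P i k * P j l * B i j * B k l
      = 2 * ∑ i, ∑ j, ∑ k, ∑ l, B i j * P i k * P j l * C k l := by
    have hswap : ∑ i, ∑ j, ∑ k, ∑ l, B i j * P i k * P j l * C l k
        = -∑ i, ∑ j, ∑ k, ∑ l, B i j * P i k * P j l * C k l := by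
      rw [Finset.sum_comm, ← Finset.sum_neg_distrib]
      refine Finset.sum_congr rfl fun i _ => ?_
      rw [← Finset.sum_neg_distrib]
      refine Finset.sum_congr rfl fun j _ => ?_
      rw [Finset.sum_comm, ← Finset.sum_neg_distrib]
      refine Finset.sum_congr rfl fun k _ => ?_
      rw [← Finset.sum_neg_distrib]
      refine Finset.sum_congr rfl fun l _ => ?_
      rw [hBa j i]
      ring
    rw [two_mul]
    nth_rewrite 2 [← neg_neg (∑ i, ∑ j, ∑ k, ∑ l, B i j * P i k * P j l * C k l)]
    rw [← hswap, ← sub_eq_add_neg]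
    simp only [← Finset.sum_sub_distrib]
    refine Finset.sum_congr rfl fun i _ => Finset.sum_congr rfl fun j _ =>
      Finset.sum_congr rfl fun k _ => Finset.sum_congr rfl fun l _ => ?_
    rw [hB k l]
    ring
  have hqBp : ∑ i, ∑ j, ∑ k, ∑ l, B i j * P i k * P j l * (2 * u k * θ l)
      = 2 * ∑ i, ∑ j, q i * B i j * p j := by
    simp only [Finset.mul_sum]
    refine Finset.sum_congr rfl fun i _ => Finset.sum_congr rfl fun j _ => ?_
    rw [← hp, ← hq]
    simp only [Finset.mul_sum, Finset.sum_mul]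
    rw [Finset.sum_comm]
    refine Finset.sum_congr rfl fun k _ => Finset.sum_congr rfl fun l _ => ?_
    ring
  have hpBq : ∑ i, ∑ j, p i * B i j * q j = -∑ i, ∑ j, q i * B i j * p j := by
    rw [Finset.sum_comm, ← Finset.sum_neg_distrib]
    refine Finset.sum_congr rfl fun i _ => ?_
    rw [← Finset.sum_neg_distrib]
    refine Finset.sum_congr rfl fun j _ => ?_
    rw [hBa j i]
    ring
  have hq' : ∀ i, ∑ l, u l * P l i = q i := fun i => by
    rw [← hq]
    exact Finset.sum_congr rfl fun l _ => by rw [hPs l i, mul_comm]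
  simp only [mul_sub, Finset.sum_sub_distrib, hqBp]
  simp only [Fintype.sum_sum_type, Finset.univ_unique, Finset.sum_singleton,
    Matrix.fromBlocks_apply₁₁, Matrix.fromBlocks_apply₁₂, Matrix.fromBlocks_apply₂₁,
    Matrix.fromBlocks_apply₂₂, Matrix.of_apply, Matrix.zero_apply, mul_zero, zero_mul,
    Finset.sum_const_zero, zero_add, Finset.sum_add_distrib, hBB]
  have h_uu : ∑ i, ∑ j, P i j * s * u i * u j = u ⬝ᵥ q * s := by
    simp only [dotProduct, ← hq, Finset.mul_sum, Finset.sum_mul]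
    exact Finset.sum_congr rfl fun i _ => Finset.sum_congr rfl fun j _ => by ring
  have h_uu' : ∑ i, ∑ j, s * P i j * -u i * -u j = u ⬝ᵥ q * s := by
    rw [← h_uu]
    exact Finset.sum_congr rfl fun i _ => Finset.sum_congr rfl fun j _ => by ring
  have h_up : ∑ i, ∑ j, -p j * -p i * -u i * u j = -(u ⬝ᵥ p) ^ 2 := by
    simp only [dotProduct, sq, Finset.sum_mul_sum, ← Finset.sum_neg_distrib]
    exact Finset.sum_congr rfl fun i _ => Finset.sum_congr rfl fun j _ => by ring
  have h_up' : ∑ i, ∑ j, -p i * -p j * u i * -u j = -(u ⬝ᵥ p) ^ 2 := by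
    rw [← h_up]
    exact Finset.sum_congr rfl fun i _ => Finset.sum_congr rfl fun j _ => by ring
  have h_PB : ∑ i, ∑ j, ∑ k, P i k * -p j * B i j * u k = -∑ i, ∑ j, q i * B i j * p j := by
    simp only [← hq, Finset.sum_mul, ← Finset.sum_neg_distrib]
    exact Finset.sum_congr rfl fun i _ => Finset.sum_congr rfl fun j _ =>
      Finset.sum_congr rfl fun k _ => by ring
  have h_pB : ∑ i, ∑ j, ∑ k, -p i * P j k * B i j * -u k = ∑ i, ∑ j, p i * B i j * q j := by
    simp only [← hq, Finset.mul_sum]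
    exact Finset.sum_congr rfl fun i _ => Finset.sum_congr rfl fun j _ =>
      Finset.sum_congr rfl fun k _ => by ring
  have h_BP : ∑ i, ∑ j, ∑ k, P i j * -p k * u i * B j k = -∑ i, ∑ j, q i * B i j * p j := by
    simp only [← hq', Finset.sum_mul, ← Finset.sum_neg_distrib]
    rw [Finset.sum_comm]
    refine Finset.sum_congr rfl fun j _ => ?_
    rw [Finset.sum_comm]
    exact Finset.sum_congr rfl fun k _ => Finset.sum_congr rfl fun i _ => by ring
  have h_Bp : ∑ i, ∑ j, ∑ k, -p j * P i k * -u i * B j k = ∑ i, ∑ j, p i * B i j * q j := by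
    simp only [← hq', Finset.mul_sum]
    rw [Finset.sum_comm]
    refine Finset.sum_congr rfl fun j _ => ?_
    rw [Finset.sum_comm]
    exact Finset.sum_congr rfl fun k _ => Finset.sum_congr rfl fun i _ => by ring
  rw [h_PB, h_pB, h_BP, h_Bp, h_uu, h_uu', h_up, h_up', hpBq]
  ring
end

section
/- Let d, c be real numbers with d < 1 and c < 0, let α be an odd positive integer, let a be the real number with a^α = (1 − d)/(c(α + 1)), set e = ((α(1 − 2d) − 1)/(2(α + 1))) a and f(R) = dR + cR^{α+1} + e. Then a ≠ 0, f''(a) = cα(α + 1)a^{α−1} ≠ 0, 1/f''(a) = a/(α(1 − d)), and the second derivative of the potential satisfies 𝒱''(0) = (1/3)(a − 4f(a) + 1/f''(a)) = (a/3)(1/((1 − d)α) − 1). Moreover 𝒱''(0) < 0 if and only if d > (α − 1)/α. -/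
theorem hasDerivAt_linear_add_pow_add_const (d c e : ℝ) (n : ℕ) (x : ℝ) :
    HasDerivAt (fun R : ℝ => d * R + c * R ^ (n + 1) + e) (d + c * ((n + 1) * x ^ n)) x := by
  have h := (((hasDerivAt_id x).const_mul d).add
    ((hasDerivAt_pow (n + 1) x).const_mul c)).add_const e
  simpa using h

theorem deriv_deriv_linear_add_pow_add_const (d c e : ℝ) (n : ℕ) (x : ℝ) :
    deriv (deriv fun R : ℝ => d * R + c * R ^ (n + 1) + e) x =
      c * n * (n + 1) * x ^ (n - 1) := by
  have h : deriv (fun R : ℝ => d * R + c * R ^ (n + 1) + e) =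
      fun R => d + c * ((n + 1) * R ^ n) :=
    funext fun R => (hasDerivAt_linear_add_pow_add_const d c e n R).deriv
  rw [h, ((((hasDerivAt_pow n x).const_mul ((n : ℝ) + 1)).const_mul c).const_add d).deriv]
  ring


/-- With d < 1, c < 0, α an odd positive integer, a the real number with
a^α = (1 − d)/(c(α + 1)), e = ((α(1 − 2d) − 1)/(2(α + 1))) a and
f(R) = dR + cR^{α+1} + e, one has a ≠ 0, f''(a) = cα(α + 1)a^{α−1} ≠ 0,
1/f''(a) = a/(α(1 − d)), and
𝒱''(0) = (1/3)(a − 4f(a) + 1/f''(a)) = (a/3)(1/((1 − d)α) − 1).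
Moreover 𝒱''(0) < 0 iff d > (α − 1)/α. -/
theorem fR_potential_second_derivative (d c : ℝ) (hd : d < 1) (hc : c < 0)
    (α : ℕ) (hα : 0 < α) (hodd : Odd α)
    (a : ℝ) (ha : a ^ α = (1 - d) / (c * (α + 1))) :
    let e : ℝ := ((α : ℝ) * (1 - 2 * d) - 1) / (2 * ((α : ℝ) + 1)) * a
    let f : ℝ → ℝ := fun R => d * R + c * R ^ (α + 1) + e
    a ≠ 0 ∧
    deriv (deriv f) a = c * α * (α + 1) * a ^ (α - 1) ∧
    c * α * (α + 1) * a ^ (α - 1) ≠ 0 ∧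
    1 / (c * α * (α + 1) * a ^ (α - 1)) = a / (α * (1 - d)) ∧
    (1 / 3) * (a - 4 * f a + 1 / (c * α * (α + 1) * a ^ (α - 1))) =
      a / 3 * (1 / ((1 - d) * α) - 1) ∧
    (a / 3 * (1 / ((1 - d) * α) - 1) < 0 ↔ d > ((α : ℝ) - 1) / α) := by
  intro e f
  have hα' : (0 : ℝ) < α := Nat.cast_pos.mpr hα
  have hd' : 0 < 1 - d := sub_pos.mpr hd
  have ha_neg : a < 0 := by
    rw [← hodd.pow_neg_iff, ha]
    exact div_neg_of_pos_of_neg hd' (mul_neg_of_neg_of_pos hc (by positivity))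
  have ha0 : a ≠ 0 := ha_neg.ne
  have hpow : c * (α + 1) * a ^ α = 1 - d := by
    rw [ha]
    field_simp [hc.ne]
  have hf : f a = a / 2 := by
    have h : c * a ^ (α + 1) = (1 - d) / (α + 1) * a := by
      rw [← hpow, pow_succ]
      field_simp
    simp only [f, e, h]
    field_simp
    ring
  have hmul : c * α * (α + 1) * a ^ (α - 1) * a = α * (1 - d) := by
    rw [mul_assoc, pow_sub_one_mul hα.ne', ← hpow]
    ring
  have hne : c * α * (α + 1) * a ^ (α - 1) ≠ 0 := by
    intro h
    rw [h, zero_mul] at hmul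
    exact (mul_pos hα' hd').ne hmul
  have hinv : 1 / (c * α * (α + 1) * a ^ (α - 1)) = a / (α * (1 - d)) := by
    rw [div_eq_div_iff hne (mul_pos hα' hd').ne']
    linarith
  refine ⟨ha0, deriv_deriv_linear_add_pow_add_const d c e α a, hne, hinv, ?_, ?_⟩
  · rw [hinv, hf]
    field_simp
    ring
  · rw [← neg_pos, ← neg_mul, mul_pos_iff_of_pos_left (neg_pos.mpr (div_neg_of_neg_of_pos ha_neg three_pos)), sub_pos,
      one_lt_div (mul_pos hd' hα'), gt_iff_lt, div_lt_iff₀ hα']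
    constructor <;> intro h <;> linarith
end
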